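/- arXiv:2001.08476 — 2 statements merged into one kernel-verified Lean document; each statement's English description precedes it below -/
import Mathlib

section
/- For all integers n, m ≥ 1 and every smooth function F : Ω → ℂ, one has L_{-n}(L_{-m}F) − L_{-m}(L_{-n}F) = (m − n)·L_{-(n+m)}F at every point of Ω. -/
open scoped BigOperators

/-- The first-order differential operator `L_{-n}` acting on functions of
`(t, t₁, …, t_N) ∈ ℝ × (Fin N → ℝ)`:
`L_{-1} F = ∂_t F` and, for `n ≥ 2`,
`L_{-n} F = Σ_l ( -(t_l - t)^{-(n-1)} ∂_{t_l} F + Δ_l (n-1) (t_l - t)^{-n} F )`. -/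
noncomputable def Lop (N : ℕ) (Δ : Fin N → ℂ) (n : ℕ)
    (F : ℝ × (Fin N → ℝ) → ℂ) (p : ℝ × (Fin N → ℝ)) : ℂ :=
  if n = 1 then fderiv ℝ F p (1, 0)
  else ∑ l : Fin N,
    (-((((p.2 l : ℂ) - (p.1 : ℂ)) ^ (n - 1))⁻¹) * fderiv ℝ F p (0, Pi.single l 1)
      + Δ l * ((n : ℂ) - 1) * ((((p.2 l : ℂ) - (p.1 : ℂ)) ^ n)⁻¹) * F p)

/-- The domain `Ω = {(t, t₁, …, t_N) : t ≠ t_l for all l}`. -/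
def Domain (N : ℕ) : Set (ℝ × (Fin N → ℝ)) := {p | ∀ l, p.1 ≠ p.2 l}

/-- The domain `Ω` is open. -/
theorem isOpen_Domain (N : ℕ) : IsOpen (Domain N) := by
  simp only [Domain, Set.ofPred_forall]
  exact isOpen_iInter_of_finite fun l => isOpen_ne_fun (by fun_prop) (by fun_prop)

/-- The commutator of two first-order operators `F ↦ dF(V) + a F` and `F ↦ dF(W) + b F`. -/
theorem commutator_fderiv_add_mul {E : Type*} [NormedAddCommGroup E] [NormedSpace ℝ E]
    {F : E → ℂ} {V W : E → E} {a b : E → ℂ} {V' W' : E →L[ℝ] E} {a' b' : E →L[ℝ] ℂ} {p : E}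
    (hF : ContDiffAt ℝ 2 F p) (hV : HasFDerivAt V V' p) (hW : HasFDerivAt W W' p)
    (ha : HasFDerivAt a a' p) (hb : HasFDerivAt b b' p) :
    (fderiv ℝ (fun q => fderiv ℝ F q (W q) + b q * F q) p (V p)
        + a p * (fderiv ℝ F p (W p) + b p * F p))
      - (fderiv ℝ (fun q => fderiv ℝ F q (V q) + a q * F q) p (W p)
        + b p * (fderiv ℝ F p (V p) + a p * F p))
      = fderiv ℝ F p (W' (V p) - V' (W p)) + (b' (V p) - a' (W p)) * F p := by
  have hd : HasFDerivAt F (fderiv ℝ F p) p := (hF.differentiableAt (by norm_num)).hasFDerivAt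
  have hdd : HasFDerivAt (fderiv ℝ F) (fderiv ℝ (fderiv ℝ F) p) p :=
    ((hF.fderiv_right (m := 1) (by norm_num)).differentiableAt (by norm_num)).hasFDerivAt
  have hsymm : IsSymmSndFDerivAt ℝ F p := hF.isSymmSndFDerivAt (by simp)
  rw [((hdd.clm_apply hW).fun_add (hb.fun_mul hd)).fderiv,
    ((hdd.clm_apply hV).fun_add (ha.fun_mul hd)).fderiv]
  simp only [add_apply, ContinuousLinearMap.comp_apply,
    ContinuousLinearMap.flip_apply, smul_apply, smul_eq_mul, map_sub]
  rw [hsymm.eq (V p) (W p)]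
  ring

/-- The differential of `q ↦ t_l - t`. -/
noncomputable def gapCLM (N : ℕ) (l : Fin N) : ℝ × (Fin N → ℝ) →L[ℝ] ℝ :=
  (ContinuousLinearMap.proj l).comp (ContinuousLinearMap.snd ℝ ℝ (Fin N → ℝ))
    - ContinuousLinearMap.fst ℝ ℝ (Fin N → ℝ)

theorem gapCLM_apply (N : ℕ) (l : Fin N) (q : ℝ × (Fin N → ℝ)) :
    gapCLM N l q = q.2 l - q.1 := by
  simp [gapCLM]

theorem hasFDerivAt_inv_gap_pow {N : ℕ} {p : ℝ × (Fin N → ℝ)} (hp : p ∈ Domain N)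
    (l : Fin N) (k : ℕ) :
    HasFDerivAt (fun q => ((gapCLM N l q) ^ k)⁻¹)
      ((-(k : ℝ) * ((gapCLM N l p) ^ (k + 1))⁻¹) • gapCLM N l) p := by
  have hx : gapCLM N l p ≠ 0 := by
    rw [gapCLM_apply]
    exact sub_ne_zero.mpr (hp l).symm
  have h : HasDerivAt (fun x : ℝ => (x ^ k)⁻¹)
      (-(k : ℝ) * ((gapCLM N l p) ^ (k + 1))⁻¹) (gapCLM N l p) := by
    refine ((hasDerivAt_pow k (gapCLM N l p)).fun_inv (pow_ne_zero k hx)).congr_deriv ?_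
    rcases k with _ | k
    · simp
    · simp only [Nat.add_sub_cancel]
      field_simp
      ring
  exact h.comp_hasFDerivAt p (gapCLM N l).hasFDerivAt

/-- The vector field of the principal part of `L_{-(k+1)}`. -/
noncomputable def principalField (N k : ℕ) (q : ℝ × (Fin N → ℝ)) : ℝ × (Fin N → ℝ) :=
  (if k = 0 then 1 else 0, fun l => (if k = 0 then 1 else 0) - ((gapCLM N l q) ^ k)⁻¹)

/-- The zeroth-order coefficient of `L_{-(k+1)}`. -/
noncomputable def potential (N : ℕ) (Δ : Fin N → ℂ) (k : ℕ) (q : ℝ × (Fin N → ℝ)) : ℂ :=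
  ∑ l, Δ l * k * ((((gapCLM N l q) ^ (k + 1))⁻¹ : ℝ) : ℂ)

theorem gapCLM_principalField (N k : ℕ) (l : Fin N) (q : ℝ × (Fin N → ℝ)) :
    gapCLM N l (principalField N k q) = -((gapCLM N l q) ^ k)⁻¹ := by
  rw [gapCLM_apply, principalField]
  ring

theorem Lop_succ_eq (N : ℕ) (Δ : Fin N → ℂ) (k : ℕ) (F : ℝ × (Fin N → ℝ) → ℂ) :
    Lop N Δ (k + 1) F
      = fun q => fderiv ℝ F q (principalField N k q) + potential N Δ k q * F q := by
  funext q
  rcases Nat.eq_zero_or_pos k with rfl | hk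
  · have hV : principalField N 0 q = (1, 0) := by
      ext <;> simp [principalField]
    simp [Lop, potential, hV]
  · have hV : principalField N k q
        = ∑ l, (-((gapCLM N l q) ^ k)⁻¹) • ((0, Pi.single l 1) : ℝ × (Fin N → ℝ)) := by
      ext i
      · simp [principalField, hk.ne', Prod.fst_sum]
      · simp [principalField, hk.ne', Prod.snd_sum, Finset.sum_apply, Pi.single_apply]
    rw [Lop, if_neg (by omega), hV, map_sum, potential, Finset.sum_mul, ← Finset.sum_add_distrib]
    refine Finset.sum_congr rfl fun l _ => ?_
    rw [map_smul, gapCLM_apply, Complex.real_smul]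
    push_cast
    simp

/-- The differential of `principalField`. -/
noncomputable def principalFieldDeriv (N k : ℕ) (p : ℝ × (Fin N → ℝ)) :
    ℝ × (Fin N → ℝ) →L[ℝ] ℝ × (Fin N → ℝ) :=
  (0 : ℝ × (Fin N → ℝ) →L[ℝ] ℝ).prod
    (ContinuousLinearMap.pi fun l => -((-(k : ℝ) * ((gapCLM N l p) ^ (k + 1))⁻¹) • gapCLM N l))

theorem hasFDerivAt_principalField {N : ℕ} {p : ℝ × (Fin N → ℝ)} (hp : p ∈ Domain N) (k : ℕ) :
    HasFDerivAt (principalField N k) (principalFieldDeriv N k p) p :=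
  (hasFDerivAt_const _ p).prodMk
    (hasFDerivAt_pi.mpr fun l => (hasFDerivAt_inv_gap_pow hp l k).const_sub _)

/-- The differential of `potential`. -/
noncomputable def potentialDeriv (N : ℕ) (Δ : Fin N → ℂ) (k : ℕ) (p : ℝ × (Fin N → ℝ)) :
    ℝ × (Fin N → ℝ) →L[ℝ] ℂ :=
  ∑ l, (Δ l * k) • Complex.ofRealCLM.comp
    ((-((k + 1 : ℕ) : ℝ) * ((gapCLM N l p) ^ (k + 1 + 1))⁻¹) • gapCLM N l)

theorem hasFDerivAt_potential {N : ℕ} (Δ : Fin N → ℂ) {p : ℝ × (Fin N → ℝ)}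
    (hp : p ∈ Domain N) (k : ℕ) :
    HasFDerivAt (potential N Δ k) (potentialDeriv N Δ k p) p :=
  HasFDerivAt.fun_sum fun l _ =>
    (Complex.ofRealCLM.hasFDerivAt.comp p (hasFDerivAt_inv_gap_pow hp l (k + 1))).const_mul _

theorem principalFieldDeriv_bracket (N j k : ℕ) (p : ℝ × (Fin N → ℝ)) :
    principalFieldDeriv N k p (principalField N j p)
        - principalFieldDeriv N j p (principalField N k p)
      = ((k : ℝ) - j) • principalField N (j + k + 1) p := by
  ext l
  · simp [principalFieldDeriv, principalField]
  · simp [principalFieldDeriv, gapCLM_principalField]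
    simp [principalField]
    ring

theorem potentialDeriv_bracket (N : ℕ) (Δ : Fin N → ℂ) (j k : ℕ) (p : ℝ × (Fin N → ℝ)) :
    potentialDeriv N Δ k p (principalField N j p)
        - potentialDeriv N Δ j p (principalField N k p)
      = ((k : ℂ) - j) * potential N Δ (j + k + 1) p := by
  simp only [potentialDeriv, potential, sum_apply, Finset.mul_sum,
    ← Finset.sum_sub_distrib]
  refine Finset.sum_congr rfl fun l _ => ?_
  simp [gapCLM_principalField]
  ring

/-- Commutation relation: for all `n, m ≥ 1` and every smooth `F` on `Ω`,
`L_{-n}(L_{-m}F) − L_{-m}(L_{-n}F) = (m − n) L_{-(n+m)} F` at every point of `Ω`. -/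
theorem commutation_Lop (N : ℕ) (hN : 1 ≤ N) (Δ : Fin N → ℂ)
    (n m : ℕ) (hn : 1 ≤ n) (hm : 1 ≤ m)
    (F : ℝ × (Fin N → ℝ) → ℂ) (hF : ContDiffOn ℝ (⊤ : ℕ∞) F (Domain N)) :
    ∀ p ∈ Domain N,
      Lop N Δ n (Lop N Δ m F) p - Lop N Δ m (Lop N Δ n F) p
        = ((m : ℂ) - (n : ℂ)) * Lop N Δ (n + m) F p := by
  intro p hp
  obtain ⟨j, rfl⟩ := Nat.exists_eq_add_of_le' hn
  obtain ⟨k, rfl⟩ := Nat.exists_eq_add_of_le' hm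
  have hF2 : ContDiffAt ℝ 2 F p :=
    (hF.contDiffAt ((isOpen_Domain N).mem_nhds hp)).of_le (WithTop.coe_le_coe.mpr le_top)
  rw [show j + 1 + (k + 1) = j + k + 1 + 1 by ring]
  simp only [Lop_succ_eq]
  rw [commutator_fderiv_add_mul hF2 (hasFDerivAt_principalField hp j)
      (hasFDerivAt_principalField hp k) (hasFDerivAt_potential Δ hp j)
      (hasFDerivAt_potential Δ hp k),
    principalFieldDeriv_bracket, potentialDeriv_bracket, map_smul, Complex.real_smul]
  push_cast
  ring
end

section
/- Let r ≥ 1 be an integer, γ ∈ ℂ∖{0}, and χ = γ/2 or χ = 2/γ. Let α_1,…,α_N ∈ ℂ and set Q = γ/2 + 2/γ and Δ_l = (α_l/2)(Q − α_l/2). Then the Benoît–Saint-Aubin operator of order r annihilates the Coulomb gas integrand: 𝒟_r f = 0 at every point of the ordered domain {t < t_1 < ⋯ < t_N}. -/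
open scoped BigOperators

/-- Compositions of `r` into `k` positive parts, as functions `Fin k → ℕ`. -/
def comps (r k : ℕ) : Finset (Fin k → ℕ) :=
  (Fintype.piFinset fun _ : Fin k => Finset.Icc 1 r).filter fun n => ∑ i, n i = r

/-- The Benoît–Saint-Aubin coefficient
`(χ²)^{r−k} / ∏_{j=1}^{k−1} (Σ_{i=1}^j n_i)(Σ_{i=j+1}^k n_i)`. -/
noncomputable def BSAcoeff (r k : ℕ) (χ : ℂ) (n : Fin k → ℕ) : ℂ :=
  χ ^ (2 * (r - k)) /
    ∏ j ∈ Finset.range (k - 1),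
      ((∑ i ∈ Finset.univ.filter (fun i : Fin k => (i : ℕ) ≤ j), (n i : ℂ)) *
        (∑ i ∈ Finset.univ.filter (fun i : Fin k => j < (i : ℕ)), (n i : ℂ)))

/-- The Benoît–Saint-Aubin operator of order `r`:
`𝒟_r = Σ_{k=1}^r Σ_{n₁+⋯+n_k=r, n_i ≥ 1} BSAcoeff · L_{-n₁}∘⋯∘L_{-n_k}`. -/
noncomputable def Dr (N : ℕ) (Δ : Fin N → ℂ) (r : ℕ) (χ : ℂ)
    (F : ℝ × (Fin N → ℝ) → ℂ) (p : ℝ × (Fin N → ℝ)) : ℂ :=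
  ∑ k ∈ Finset.Icc 1 r, ∑ n ∈ comps r k,
    BSAcoeff r k χ n * ((List.ofFn n).foldr (Lop N Δ) F) p

/-- The Coulomb gas integrand
`f(t,𝐭) = ∏_{i<j} (t_j − t_i)^{−α_iα_j/2} · ∏_i (t_i − t)^{(r−1)χα_i/2}`,
with complex powers of positive reals. -/
noncomputable def fCG (N : ℕ) (r : ℕ) (χ : ℂ) (α : Fin N → ℂ)
    (p : ℝ × (Fin N → ℝ)) : ℂ :=
  (∏ i : Fin N, ∏ j ∈ Finset.Ioi i,
      (((p.2 j - p.2 i : ℝ) : ℂ) ^ (-(α i * α j) / 2))) *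
    ∏ i : Fin N, (((p.2 i - p.1 : ℝ) : ℂ) ^ (((r : ℂ) - 1) * χ * α i / 2))

/-- The ordered domain `{t < t₁ < ⋯ < t_N}`. -/
def OrdDomain (N : ℕ) : Set (ℝ × (Fin N → ℝ)) :=
  {p | (∀ l, p.1 < p.2 l) ∧ StrictMono p.2}

section Combinatorics

/-- The weight of a composition of `m ≤ r`, read from the head: the entry `a` in front of a tail
`l` contributes `χ ^ (2 * (a - 1))`, and a nonempty tail contributes
`1 / (l.sum * (r - l.sum))`. -/
noncomputable def listWeight (r : ℕ) (χ : ℂ) : List ℕ → ℂ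
  | [] => 1
  | a :: l => χ ^ (2 * (a - 1)) *
      (if l.sum = 0 then 1 else ((l.sum : ℂ) * ((r : ℂ) - l.sum))⁻¹) * listWeight r χ l

lemma le_sum_of_pos {k : ℕ} (n : Fin k → ℕ) (hn : ∀ i, 1 ≤ n i) : k ≤ ∑ i, n i := by
  simpa using Finset.sum_le_sum fun i (_ : i ∈ Finset.univ) => hn i

lemma listWeight_ofFn (r : ℕ) (χ : ℂ) (k : ℕ) (n : Fin k → ℕ) (hn : ∀ i, 1 ≤ n i) :
    listWeight r χ (List.ofFn n) = χ ^ (2 * (∑ i, n i - k)) /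
      ∏ j ∈ Finset.range (k - 1),
        (((r : ℂ) - ∑ i ∈ Finset.univ.filter (fun i : Fin k => j < (i : ℕ)), (n i : ℂ)) *
          ∑ i ∈ Finset.univ.filter (fun i : Fin k => j < (i : ℕ)), (n i : ℂ)) := by
  induction k with
  | zero => simp [listWeight]
  | succ k ih =>
    have hpow : χ ^ (2 * (∑ i, n i - (k + 1))) =
        χ ^ (2 * (n 0 - 1)) * χ ^ (2 * (∑ i : Fin k, n i.succ - k)) := by
      rw [← pow_add]
      congr 1
      have := le_sum_of_pos (fun i : Fin k => n i.succ) fun i => hn _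
      have := hn 0
      rw [Fin.sum_univ_succ]
      omega
    rw [List.ofFn_succ, listWeight, ih (fun i => n i.succ) fun i => hn _, List.sum_ofFn, hpow]
    rcases k with _ | k
    · simp
    · have hpos : ∑ i : Fin (k + 1), n i.succ ≠ 0 := by
        have := le_sum_of_pos (fun i : Fin (k + 1) => n i.succ) fun i => hn _
        omega
      rw [if_neg hpos]
      simp only [Nat.add_sub_cancel]
      rw [Finset.prod_range_succ']
      simp only [Finset.sum_filter, Fin.sum_univ_succ (n := k + 1), Fin.val_succ, Fin.val_zero,
        add_lt_add_iff_right, not_lt_zero, if_false, zero_add, lt_irrefl, Nat.succ_pos, if_true]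
      push_cast
      rw [div_eq_mul_inv, div_eq_mul_inv, mul_inv, mul_inv]
      simp only [mul_inv]
      ring

lemma BSAcoeff_eq_listWeight (r k : ℕ) (χ : ℂ) (n : Fin k → ℕ) (hn : n ∈ comps r k) :
    BSAcoeff r k χ n = listWeight r χ (List.ofFn n) := by
  simp only [comps, Finset.mem_filter, Fintype.mem_piFinset, Finset.mem_Icc] at hn
  rw [listWeight_ofFn r χ k n fun i => (hn.1 i).1, BSAcoeff, hn.2]
  congr 1
  refine Finset.prod_congr rfl fun j _ => ?_
  congr 1
  rw [eq_sub_iff_add_eq, ← hn.2]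
  push_cast
  rw [← Finset.sum_filter_add_sum_filter_not Finset.univ (fun i : Fin k => (i : ℕ) ≤ j)]
  simp only [not_le]

lemma sum_comps_succ {M : Type*} [AddCommMonoid M] (m k : ℕ) (g : List ℕ → M) :
    ∑ n ∈ comps m (k + 1), g (List.ofFn n) =
      ∑ a ∈ Finset.Icc 1 m, ∑ n ∈ comps (m - a) k, g (a :: List.ofFn n) := by
  rw [Finset.sum_sigma']
  refine Finset.sum_nbij' (fun n => ⟨n 0, fun i => n i.succ⟩) (fun x => Fin.cons x.1 x.2)
    ?_ ?_ ?_ ?_ ?_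
  · intro n hn
    simp only [comps, Finset.mem_filter, Fintype.mem_piFinset, Finset.mem_Icc,
      Finset.mem_sigma, Fin.sum_univ_succ] at hn ⊢
    refine ⟨hn.1 0, fun i => ⟨(hn.1 _).1, ?_⟩, by omega⟩
    have := Finset.single_le_sum (f := fun i : Fin k => n i.succ) (fun _ _ => Nat.zero_le _)
      (Finset.mem_univ i)
    omega
  · rintro ⟨a, n⟩ hn
    simp only [comps, Finset.mem_filter, Fintype.mem_piFinset, Finset.mem_Icc,
      Finset.mem_sigma, Fin.sum_univ_succ, Fin.cons_zero, Fin.cons_succ] at hn ⊢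
    refine ⟨Fin.cases ?_ fun i => ?_, by omega⟩
    · simpa using hn.1
    · have := hn.2.1 i
      simp only [Fin.cons_succ]
      omega
  · intro n _
    exact Fin.cons_self_tail n
  · rintro ⟨a, n⟩ _
    simp
  · intro n _
    rw [List.ofFn_succ]

lemma sum_comps_zero {M : Type*} [AddCommMonoid M] (m : ℕ) (g : List ℕ → M) :
    ∑ n ∈ comps m 0, g (List.ofFn n) = if m = 0 then g [] else 0 := by
  split_ifs with h <;> simp [comps, h, eq_comm]

lemma list_sum_of_mem_comps {m k : ℕ} {n : Fin k → ℕ} (hn : n ∈ comps m k) :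
    (List.ofFn n).sum = m := by
  simp only [comps, Finset.mem_filter] at hn
  rw [List.sum_ofFn, hn.2]

/-- If `v 0 = x` and `m (r - m) v m = ∑ a, χ ^ (2 (a - 1)) L_a (v (m - a))` for all `m ≤ r`, then
the Benoît–Saint-Aubin combination of order `r` of words in the `L_a` kills `x`. -/
theorem BSA_sum_eq_zero_of_recursion {M : Type*} [AddCommGroup M] [Module ℂ M]
    (L : ℕ → M →ₗ[ℂ] M) (r : ℕ) (hr : 1 ≤ r) (χ : ℂ) (x : M) (v : ℕ → M) (h0 : v 0 = x)
    (hv : ∀ m ≤ r, ((m : ℂ) * ((r : ℂ) - m)) • v m =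
      ∑ a ∈ Finset.Icc 1 m, χ ^ (2 * (a - 1)) • L a (v (m - a))) :
    ∑ k ∈ Finset.Icc 1 r, ∑ n ∈ comps r k,
      BSAcoeff r k χ n • (List.ofFn n).foldr (fun a y => L a y) x = 0 := by
  set g : List ℕ → M := fun l => listWeight r χ l • l.foldr (fun a y => L a y) x with hg
  set T : ℕ → ℕ → M := fun k m => ∑ n ∈ comps m k, g (List.ofFn n) with hT
  set c : ℕ → ℂ := fun s => if s = 0 then 1 else ((s : ℂ) * ((r : ℂ) - s))⁻¹ with hc
  have hTsucc (k m : ℕ) : T (k + 1) m =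
      ∑ a ∈ Finset.Icc 1 m, χ ^ (2 * (a - 1)) • L a (c (m - a) • T k (m - a)) := by
    simp only [hT]
    rw [sum_comps_succ]
    refine Finset.sum_congr rfl fun a _ => ?_
    rw [Finset.smul_sum, map_sum, Finset.smul_sum]
    refine Finset.sum_congr rfl fun n hn => ?_
    simp only [hg, hc, listWeight, list_sum_of_mem_comps hn, List.foldr_cons, map_smul, smul_smul,
      mul_assoc]
  have hTzero (m : ℕ) : T 0 m = if m = 0 then x else 0 := by
    simp only [hT]
    rw [sum_comps_zero]
    simp [hg, listWeight]
  have hstep (K m : ℕ) : ∑ k ∈ Finset.range (K + 2), T k m = (if m = 0 then x else 0) +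
      ∑ a ∈ Finset.Icc 1 m, χ ^ (2 * (a - 1)) •
        L a (c (m - a) • ∑ k ∈ Finset.range (K + 1), T k (m - a)) := by
    rw [Finset.sum_range_succ', hTzero, add_comm]
    simp only [hTsucc, Finset.smul_sum, map_sum]
    rw [Finset.sum_comm]
  have hS (K : ℕ) : ∀ m ≤ K, m < r → c m • ∑ k ∈ Finset.range (K + 1), T k m = v m := by
    induction K with
    | zero =>
      intro m hm _
      obtain rfl : m = 0 := by omega
      simp [hc, hTzero, h0]
    | succ K ih =>
      intro m hm hmr
      rw [hstep]
      rcases Nat.eq_zero_or_pos m with rfl | hpos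
      · simp [hc, h0]
      · rw [if_neg (by omega), zero_add]
        have hm0 : (m : ℂ) ≠ 0 := by exact_mod_cast hpos.ne'
        have hrm : (r : ℂ) - m ≠ 0 := sub_ne_zero.2 (by exact_mod_cast hmr.ne')
        have : ∑ a ∈ Finset.Icc 1 m, χ ^ (2 * (a - 1)) •
            L a (c (m - a) • ∑ k ∈ Finset.range (K + 1), T k (m - a)) =
            ((m : ℂ) * ((r : ℂ) - m)) • v m := by
          rw [hv m hmr.le]
          refine Finset.sum_congr rfl fun a ha => ?_
          rw [Finset.mem_Icc] at ha
          rw [ih (m - a) (by omega) (by omega)]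
        rw [this, smul_smul]
        simp only [hc, if_neg hpos.ne']
        rw [inv_mul_cancel₀ (mul_ne_zero hm0 hrm), one_smul]
  obtain ⟨K, rfl⟩ : ∃ K, r = K + 1 := ⟨r - 1, by omega⟩
  have hfinal : ∑ k ∈ Finset.range (K + 2), T k (K + 1) = 0 := by
    rw [hstep, if_neg (by omega), zero_add]
    have h := hv (K + 1) le_rfl
    rw [sub_self, mul_zero, zero_smul] at h
    rw [h]
    refine Finset.sum_congr rfl fun a ha => ?_
    rw [Finset.mem_Icc] at ha
    rw [hS K (K + 1 - a) (by omega) (by omega)]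
  rw [Finset.sum_range_succ', hTzero, if_neg (by omega), add_zero] at hfinal
  rw [← hfinal, Finset.range_eq_Ico, Finset.sum_Ico_add' (fun k => T k (K + 1)) 0 (K + 1) 1]
  refine Finset.sum_congr (by ext; simp) fun k _ => Finset.sum_congr rfl fun n hn => ?_
  rw [BSAcoeff_eq_listWeight _ _ _ _ hn]

end Combinatorics

section PowerSeriesIdentities

open Finset.HasAntidiagonal (antidiagonal)

open PowerSeries in
/-- The Euler derivation `X d/dX` on formal power series. -/
noncomputable def eulerD : Derivation ℂ (PowerSeries ℂ) (PowerSeries ℂ) :=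
  (X : PowerSeries ℂ) • derivative ℂ

open PowerSeries in
lemma coeff_eulerD (F : PowerSeries ℂ) (n : ℕ) : coeff n (eulerD F) = n * coeff n F := by
  change coeff n (X * derivative ℂ F) = _
  rcases n with _ | n
  · simp
  · rw [coeff_succ_X_mul, coeff_derivative]
    push_cast
    ring

/-- If the Euler derivation maps a series `V` to `-A V`, it maps `W V` to the product with `V` of
the image of `W` minus `A W`. Here this is read off coefficientwise, with `a`, `w`, `v` the
coefficients of `A`, `W`, `V`. -/
lemma antidiagonal_parameter_deriv (a w v : ℕ → ℂ)
    (hv : ∀ m : ℕ, (m : ℂ) * v m = -∑ x ∈ antidiagonal m, a x.1 * v x.2) (m : ℕ) :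
    ∑ x ∈ antidiagonal m,
      (a x.1 * ∑ y ∈ antidiagonal x.2, w y.1 * v y.2 + v x.2 * (-(x.1 : ℂ) * w x.1)) =
    -(m : ℂ) * ∑ x ∈ antidiagonal m, w x.1 * v x.2 := by
  have hV : eulerD (.mk v) = -(.mk a * .mk v) := by
    ext n
    simp [coeff_eulerD, PowerSeries.coeff_mul, hv]
  have key : PowerSeries.mk a * (.mk w * .mk v) - eulerD (.mk w) * .mk v =
      -eulerD (.mk w * .mk v) := by
    rw [Derivation.leibniz, hV]
    simp only [smul_eq_mul]
    ring
  have := congrArg (PowerSeries.coeff m) key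
  simp only [map_sub, map_neg, PowerSeries.coeff_mul, coeff_eulerD, PowerSeries.coeff_mk] at this
  rw [neg_mul, ← this, ← Finset.sum_sub_distrib]
  refine Finset.sum_congr rfl fun x _ => ?_
  ring

lemma sum_Icc_eq_sum_antidiagonal {M : Type*} [AddCommMonoid M] (m : ℕ) (G : ℕ → ℕ → M) :
    ∑ a ∈ Finset.Icc 1 m, G a (m - a) =
      ∑ x ∈ antidiagonal m, if x.1 = 0 then 0 else G x.1 x.2 := by
  rw [Finset.Nat.sum_antidiagonal_eq_sum_range_succ (fun a b => if a = 0 then 0 else G a b)]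
  have hsub : Finset.Icc 1 m ⊆ Finset.range m.succ := fun a ha => by simp at ha ⊢; omega
  rw [← Finset.sum_subset hsub]
  · refine Finset.sum_congr rfl fun a ha => ?_
    rw [Finset.mem_Icc] at ha
    rw [if_neg (by omega)]
  · intro a ha ha'
    simp only [Finset.mem_range, Finset.mem_Icc] at ha ha'
    rw [if_pos (by omega)]

lemma sum_antidiagonal_assoc {M : Type*} [AddCommMonoid M] (m : ℕ) (g : ℕ → ℕ → ℕ → M) :
    ∑ x ∈ antidiagonal m, ∑ y ∈ antidiagonal x.2, g x.1 y.1 y.2 =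
      ∑ x ∈ antidiagonal m, ∑ y ∈ antidiagonal x.1, g y.1 y.2 x.2 := by
  rw [Finset.sum_sigma', Finset.sum_sigma']
  refine Finset.sum_nbij' (fun x => ⟨(x.1.1 + x.2.1, x.2.2), (x.1.1, x.2.1)⟩)
    (fun x => ⟨(x.2.1, x.2.2 + x.1.2), (x.2.2, x.1.2)⟩) ?_ ?_ ?_ ?_ fun _ _ => rfl <;>
  · rintro ⟨⟨a, b⟩, c, d⟩ h
    simp only [Finset.mem_sigma, Finset.HasAntidiagonal.mem_antidiagonal] at h ⊢
    obtain ⟨h₁, h₂⟩ := h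
    subst h₁
    subst h₂
    simp [add_assoc]

lemma sum_antidiagonal_off_axes (P : ℕ → ℂ) (hP : P 0 = 0) (s : ℕ) :
    (∑ y ∈ antidiagonal s, if y.1 = 0 then 0 else if y.2 = 0 then 0 else P s) =
      ((s : ℂ) - 1) * P s := by
  rcases s with _ | s
  · simp [hP]
  · rw [Finset.Nat.sum_antidiagonal_succ, Finset.Nat.sum_antidiagonal_eq_sum_range_succ_mk,
      Finset.sum_range_succ, Finset.sum_congr rfl (g := fun _ => P (s + 1)) fun i hi => by
        rw [Finset.mem_range] at hi
        rw [if_neg (by omega), if_neg (by simp only; omega)]]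
    simp

/-- The recursion satisfied by the coefficients of `∏ (1 - χ² y z)^{α/(2χ)}` under the Virasoro
modes of the charged Fock representation. -/
lemma fock_recursion (χ Q ρ : ℂ) (hχ : χ ≠ 0) (hQ : Q = χ + χ⁻¹) (P v : ℕ → ℂ) (hP : P 0 = 0)
    (hv : ∀ m : ℕ, (m : ℂ) * v m =
      -∑ x ∈ antidiagonal m, χ⁻¹ * (χ ^ 2) ^ x.1 * P x.1 * v x.2) (m : ℕ) :
    ∑ a ∈ Finset.Icc 1 m, χ ^ (2 * (a - 1)) *
      ((∑ x ∈ antidiagonal (m - a),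
          χ⁻¹ * (χ ^ 2) ^ x.1 * (if x.1 = 0 then 0 else -P (x.1 + a)) * v x.2) +
        (-∑ x ∈ antidiagonal a, P x.1 * P x.2
          + (((a : ℂ) - 1) * Q - (ρ - 1) * χ) * P a) * v (m - a)) =
      (m : ℂ) * (ρ - m) * v m := by
  set A : PowerSeries ℂ := .mk fun k => χ⁻¹ * (χ ^ 2) ^ k * P k with hA
  set V : PowerSeries ℂ := .mk v with hV
  have hDV : eulerD V = -(A * V) := by
    ext n
    simp [hA, hV, coeff_eulerD, PowerSeries.coeff_mul, hv]
  have hDDV : eulerD (eulerD V) = -eulerD A * V + A * A * V := by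
    rw [hDV, map_neg, Derivation.leibniz, hDV]
    simp only [smul_eq_mul]
    ring
  have hAA (s : ℕ) : PowerSeries.coeff s (A * A) =
      χ⁻¹ ^ 2 * (χ ^ 2) ^ s * ∑ x ∈ antidiagonal s, P x.1 * P x.2 := by
    rw [PowerSeries.coeff_mul, Finset.mul_sum]
    refine Finset.sum_congr rfl fun x hx => ?_
    rw [Finset.HasAntidiagonal.mem_antidiagonal] at hx
    simp only [hA, PowerSeries.coeff_mk, ← hx, pow_add]
    ring
  have hfirst : ∑ a ∈ Finset.Icc 1 m, χ ^ (2 * (a - 1)) *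
      (∑ x ∈ antidiagonal (m - a),
          χ⁻¹ * (χ ^ 2) ^ x.1 * (if x.1 = 0 then 0 else -P (x.1 + a)) * v x.2) =
      PowerSeries.coeff m (-(χ⁻¹ ^ 2) • ((eulerD A - A) * V)) := by
    have hG (a : ℕ) (ha : a ∈ Finset.Icc 1 m) : χ ^ (2 * (a - 1)) *
        (∑ x ∈ antidiagonal (m - a),
          χ⁻¹ * (χ ^ 2) ^ x.1 * (if x.1 = 0 then 0 else -P (x.1 + a)) * v x.2) =
        ∑ x ∈ antidiagonal (m - a), if x.1 = 0 then 0 else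
          -(χ⁻¹ ^ 3) * (χ ^ 2) ^ (a + x.1) * P (a + x.1) * v x.2 := by
      rw [Finset.mem_Icc] at ha
      obtain ⟨b, rfl⟩ : ∃ b, a = b + 1 := ⟨a - 1, by omega⟩
      rw [Finset.mul_sum]
      refine Finset.sum_congr rfl fun x _ => ?_
      split_ifs
      · simp
      · rw [Nat.add_sub_cancel, add_comm x.1]
        field_simp
        ring
    rw [Finset.sum_congr rfl hG, sum_Icc_eq_sum_antidiagonal m fun a b =>
      ∑ x ∈ antidiagonal b, if x.1 = 0 then 0 else
          -(χ⁻¹ ^ 3) * (χ ^ 2) ^ (a + x.1) * P (a + x.1) * v x.2]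
    have hpush (x : ℕ × ℕ) : (if x.1 = 0 then 0 else ∑ y ∈ antidiagonal x.2,
          if y.1 = 0 then 0 else -(χ⁻¹ ^ 3) * (χ ^ 2) ^ (x.1 + y.1) * P (x.1 + y.1) * v y.2) =
        ∑ y ∈ antidiagonal x.2, if x.1 = 0 then 0 else if y.1 = 0 then 0 else
          -(χ⁻¹ ^ 3) * (χ ^ 2) ^ (x.1 + y.1) * P (x.1 + y.1) * v y.2 := by
      split_ifs <;> simp
    rw [Finset.sum_congr rfl fun x _ => hpush x]
    rw [sum_antidiagonal_assoc m fun a k j => if a = 0 then 0 else if k = 0 then 0 else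
          -(χ⁻¹ ^ 3) * (χ ^ 2) ^ (a + k) * P (a + k) * v j]
    rw [PowerSeries.coeff_smul, PowerSeries.coeff_mul, Finset.smul_sum]
    refine Finset.sum_congr rfl fun x _ => ?_
    have := sum_antidiagonal_off_axes P hP x.1
    simp only [map_sub, coeff_eulerD, hA, hV, PowerSeries.coeff_mk, smul_eq_mul]
    trans (-(χ⁻¹ ^ 3) * (χ ^ 2) ^ x.1 * v x.2) * (((x.1 : ℂ) - 1) * P x.1)
    · rw [← this, Finset.mul_sum]
      refine Finset.sum_congr rfl fun y hy => ?_
      rw [Finset.HasAntidiagonal.mem_antidiagonal] at hy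
      rw [hy]
      split_ifs <;> ring
    · ring
  have hsecond : ∑ a ∈ Finset.Icc 1 m, χ ^ (2 * (a - 1)) *
        ((-∑ x ∈ antidiagonal a, P x.1 * P x.2
          + (((a : ℂ) - 1) * Q - (ρ - 1) * χ) * P a) * v (m - a)) =
      PowerSeries.coeff m ((-(A * A) + (Q * χ⁻¹) • (eulerD A - A) - (ρ - 1) • A) * V) := by
    rw [sum_Icc_eq_sum_antidiagonal m fun a b => χ ^ (2 * (a - 1)) *
        ((-∑ x ∈ antidiagonal a, P x.1 * P x.2
          + (((a : ℂ) - 1) * Q - (ρ - 1) * χ) * P a) * v b), PowerSeries.coeff_mul]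
    refine Finset.sum_congr rfl fun x _ => ?_
    simp only [map_add, map_sub, map_neg, PowerSeries.coeff_smul, hAA, coeff_eulerD]
    simp only [hA, hV, PowerSeries.coeff_mk, smul_eq_mul]
    rcases x with ⟨_ | a, b⟩
    · simp [hP]
    · simp only [Nat.succ_ne_zero, if_false, Nat.add_sub_cancel]
      generalize ∑ x ∈ antidiagonal (a + 1), P x.1 * P x.2 = S
      push_cast
      field_simp
      ring
  rw [Finset.sum_congr rfl fun a _ => mul_add (χ ^ (2 * (a - 1))) _ _, Finset.sum_add_distrib,
    hfirst, hsecond, ← map_add]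
  have hrhs : (m : ℂ) * (ρ - m) * v m =
      PowerSeries.coeff m (ρ • eulerD V - eulerD (eulerD V)) := by
    simp only [map_sub, PowerSeries.coeff_smul, coeff_eulerD, hV, PowerSeries.coeff_mk,
      smul_eq_mul]
    ring
  rw [hrhs]
  congr 1
  rw [hDDV, hDV, hQ]
  have : ((χ + χ⁻¹) * χ⁻¹) = 1 + χ⁻¹ ^ 2 := by field_simp
  rw [this]
  simp only [PowerSeries.smul_eq_C_mul, map_neg, map_add, map_sub, map_one]
  ring

end PowerSeriesIdentities

section CoulombGas

open Finset.HasAntidiagonal (antidiagonal)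

variable {N : ℕ}

/-- The coordinate difference `(t, 𝐭) ↦ t_l - t`, as a complex valued linear form. -/
noncomputable def gapForm (l : Fin N) : ℝ × (Fin N → ℝ) →L[ℝ] ℂ :=
  Complex.ofRealCLM.comp
    ((ContinuousLinearMap.proj l).comp (ContinuousLinearMap.snd ℝ ℝ (Fin N → ℝ)) -
      ContinuousLinearMap.fst ℝ ℝ (Fin N → ℝ))

lemma gapForm_apply (l : Fin N) (p : ℝ × (Fin N → ℝ)) :
    gapForm l p = (p.2 l : ℂ) - (p.1 : ℂ) := by
  simp [gapForm]

/-- The function `(t_l - t)⁻¹`. -/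
noncomputable def invGap (l : Fin N) (p : ℝ × (Fin N → ℝ)) : ℂ := (gapForm l p)⁻¹

/-- The power sums `∑ (α_l / 2) (t_l - t)^{-k}` for `k ≥ 1`, set to be zero for `k = 0`. -/
noncomputable def powerSum (α : Fin N → ℂ) (k : ℕ) (p : ℝ × (Fin N → ℝ)) : ℂ :=
  if k = 0 then 0 else ∑ l, α l / 2 * invGap l p ^ k

/-- The form `∑ (α_l / 2) (t_l - t)^{-k-1} d(t_l - t)`, whose multiple by `-k` is the
differential of `powerSum α k`. -/
noncomputable def powerForm (α : Fin N → ℂ) (k : ℕ) (p : ℝ × (Fin N → ℝ)) :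
    ℝ × (Fin N → ℝ) →L[ℝ] ℂ :=
  if k = 0 then 0 else ∑ l, (α l / 2 * invGap l p ^ (k + 1)) • gapForm l

/-- The coefficients of `z ^ m` in `∏ (1 - χ² z / (t_l - t))^{α_l / (2χ)}`, defined through the
recursion coming from the logarithmic derivative in `z`. -/
noncomputable def nullCoeff (χ : ℂ) (α : Fin N → ℂ) : ℕ → ℝ × (Fin N → ℝ) → ℂ
  | 0 => fun _ => 1
  | m + 1 => fun p => -((m : ℂ) + 1)⁻¹ * ∑ k : Fin (m + 1),
      χ⁻¹ * (χ ^ 2) ^ ((k : ℕ) + 1) * powerSum α (k + 1) p * nullCoeff χ α (m - k) p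

lemma nullCoeff_succ (χ : ℂ) (α : Fin N → ℂ) (m : ℕ) (p : ℝ × (Fin N → ℝ)) :
    nullCoeff χ α (m + 1) p = -((m : ℂ) + 1)⁻¹ * ∑ x ∈ antidiagonal (m + 1),
      χ⁻¹ * (χ ^ 2) ^ x.1 * powerSum α x.1 p * nullCoeff χ α x.2 p := by
  rw [nullCoeff, Finset.Nat.sum_antidiagonal_succ,
    Finset.Nat.sum_antidiagonal_eq_sum_range_succ_mk, Finset.sum_range]
  simp [powerSum]

lemma nullCoeff_recursion (χ : ℂ) (α : Fin N → ℂ) (p : ℝ × (Fin N → ℝ)) (m : ℕ) :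
    (m : ℂ) * nullCoeff χ α m p = -∑ x ∈ antidiagonal m,
      χ⁻¹ * (χ ^ 2) ^ x.1 * powerSum α x.1 p * nullCoeff χ α x.2 p := by
  rcases m with _ | m
  · simp [powerSum]
  · have : (m : ℂ) + 1 ≠ 0 := by exact_mod_cast m.succ_ne_zero
    rw [nullCoeff_succ]
    push_cast
    field_simp

/-- Evaluation of a form on the vector field of `L_{-n}` at `p`. -/
noncomputable def modeField (n : ℕ) (p : ℝ × (Fin N → ℝ)) :
    (ℝ × (Fin N → ℝ) →L[ℝ] ℂ) →ₗ[ℂ] ℂ where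
  toFun θ := if n = 1 then θ (1, 0) else ∑ l, -(invGap l p ^ (n - 1)) * θ (0, Pi.single l 1)
  map_add' θ η := by
    split_ifs <;> simp [mul_add, Finset.sum_add_distrib]
  map_smul' c θ := by
    split_ifs
    · simp
    · simp only [smul_apply, smul_eq_mul, RingHom.id_apply, Finset.mul_sum]
      exact Finset.sum_congr rfl fun _ _ => by ring

lemma Lop_eq_modeField (Δ : Fin N → ℂ) (n : ℕ) (F : ℝ × (Fin N → ℝ) → ℂ)
    (p : ℝ × (Fin N → ℝ)) :
    Lop N Δ n F p = modeField n p (fderiv ℝ F p) +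
      ((n : ℂ) - 1) * (∑ l, Δ l * invGap l p ^ n) * F p := by
  by_cases h : n = 1
  · simp [Lop, modeField, h]
  · simp only [Lop, modeField, h, if_false, LinearMap.coe_mk, AddHom.coe_mk]
    rw [Finset.mul_sum, Finset.sum_mul, ← Finset.sum_add_distrib]
    refine Finset.sum_congr rfl fun l _ => ?_
    rw [invGap, gapForm_apply, inv_pow, inv_pow]
    ring

lemma modeField_gapForm {n : ℕ} (p : ℝ × (Fin N → ℝ)) (l : Fin N) :
    modeField n p (gapForm l) = -(invGap l p ^ (n - 1)) := by
  by_cases h : n = 1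
  · simp [modeField, h, gapForm_apply]
  · simp only [modeField, h, if_false, LinearMap.coe_mk, AddHom.coe_mk, gapForm_apply]
    rw [Finset.sum_eq_single l]
    · simp
    · intro b _ hb
      simp [hb.symm]
    · simp

lemma modeField_powerForm (α : Fin N → ℂ) {n : ℕ} (hn : 1 ≤ n) (k : ℕ) (p : ℝ × (Fin N → ℝ)) :
    modeField n p (powerForm α k p) = if k = 0 then 0 else -powerSum α (k + n) p := by
  unfold powerForm powerSum
  split_ifs with h h'
  · simp
  · omega
  · rw [map_sum, ← Finset.sum_neg_distrib]
    refine Finset.sum_congr rfl fun l _ => ?_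
    rw [map_smul, modeField_gapForm, smul_eq_mul,
      show k + n = k + 1 + (n - 1) by omega, pow_add _ (k + 1)]
    ring

lemma gapForm_ne_zero {p : ℝ × (Fin N → ℝ)} (hp : p ∈ OrdDomain N) (l : Fin N) :
    gapForm l p ≠ 0 := by
  rw [gapForm_apply, sub_ne_zero]
  exact_mod_cast (hp.1 l).ne'

lemma hasFDerivAt_invGap {p : ℝ × (Fin N → ℝ)} (hp : p ∈ OrdDomain N) (l : Fin N) :
    HasFDerivAt (invGap l) (-(invGap l p ^ 2) • gapForm l) p := by
  have h := (hasDerivAt_inv (𝕜 := ℂ) (gapForm_ne_zero hp l)).hasFDerivAt.restrictScalars ℝ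
  have := h.comp p (gapForm (N := N) l).hasFDerivAt
  refine this.congr_fderiv ?_
  ext <;> simp [invGap, mul_comm]

lemma hasFDerivAt_powerSum (α : Fin N → ℂ) (k : ℕ) {p : ℝ × (Fin N → ℝ)}
    (hp : p ∈ OrdDomain N) :
    HasFDerivAt (powerSum α k) (-(k : ℂ) • powerForm α k p) p := by
  rcases k with _ | k
  · have : powerSum α 0 = fun _ => (0 : ℂ) := by ext; simp [powerSum]
    rw [this]
    refine (hasFDerivAt_const (𝕜 := ℝ) (0 : ℂ) p).congr_fderiv ?_
    refine ContinuousLinearMap.ext fun e => ?_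
    simp
  · have : powerSum α (k + 1) = fun p => ∑ l, α l / 2 * invGap l p ^ (k + 1) := by
      ext; simp [powerSum]
    rw [this]
    refine (HasFDerivAt.fun_sum fun l (_ : l ∈ Finset.univ) =>
      ((hasFDerivAt_invGap hp l).pow (k + 1)).const_mul (α l / 2)).congr_fderiv ?_
    simp only [powerForm, Nat.succ_ne_zero, if_false, Finset.smul_sum, smul_smul]
    refine Finset.sum_congr rfl fun l _ => ?_
    ext <;> simp <;> ring

lemma hasFDerivAt_nullCoeff (χ : ℂ) (α : Fin N → ℂ) (m : ℕ) {p : ℝ × (Fin N → ℝ)}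
    (hp : p ∈ OrdDomain N) :
    HasFDerivAt (nullCoeff χ α m) (∑ x ∈ antidiagonal m,
      (χ⁻¹ * (χ ^ 2) ^ x.1 * nullCoeff χ α x.2 p) • powerForm α x.1 p) p := by
  induction m using Nat.strong_induction_on with
  | _ m ih =>
    rcases m with _ | m
    · have : nullCoeff χ α 0 = fun _ => (1 : ℂ) := by ext; simp [nullCoeff]
      rw [this]
      refine (hasFDerivAt_const (𝕜 := ℝ) (1 : ℂ) p).congr_fderiv ?_
      refine ContinuousLinearMap.ext fun e => ?_
      simp [powerForm]
    · have hterm (x : ℕ × ℕ) (hx : x ∈ antidiagonal (m + 1)) :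
          HasFDerivAt (fun q => χ⁻¹ * (χ ^ 2) ^ x.1 * powerSum α x.1 q * nullCoeff χ α x.2 q)
            ((χ⁻¹ * (χ ^ 2) ^ x.1 * powerSum α x.1 p) • (∑ y ∈ antidiagonal x.2,
                (χ⁻¹ * (χ ^ 2) ^ y.1 * nullCoeff χ α y.2 p) • powerForm α y.1 p) +
              nullCoeff χ α x.2 p • (-(x.1 : ℂ) * (χ⁻¹ * (χ ^ 2) ^ x.1)) • powerForm α x.1 p)
            p := by
        rw [Finset.HasAntidiagonal.mem_antidiagonal] at hx
        rcases Nat.eq_zero_or_pos x.1 with h0 | hpos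
        · have : (fun q => χ⁻¹ * (χ ^ 2) ^ x.1 * powerSum α x.1 q * nullCoeff χ α x.2 q) =
              fun _ => 0 := by
            ext q
            simp [h0, powerSum]
          rw [this, h0]
          refine (hasFDerivAt_const (𝕜 := ℝ) (0 : ℂ) p).congr_fderiv ?_
          refine ContinuousLinearMap.ext fun e => ?_
          simp [powerSum, powerForm]
        · refine (((hasFDerivAt_powerSum α x.1 hp).const_mul (χ⁻¹ * (χ ^ 2) ^ x.1)).mul
            (ih x.2 (by omega))).congr_fderiv ?_
          congr 2
          rw [smul_smul]
          congr 1
          ring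
      have hfun : nullCoeff χ α (m + 1) = fun q => -((m : ℂ) + 1)⁻¹ * ∑ x ∈ antidiagonal (m + 1),
          χ⁻¹ * (χ ^ 2) ^ x.1 * powerSum α x.1 q * nullCoeff χ α x.2 q := by
        ext q
        exact nullCoeff_succ χ α m q
      rw [hfun]
      refine ((HasFDerivAt.fun_sum hterm).const_mul _).congr_fderiv ?_
      refine ContinuousLinearMap.ext fun e => ?_
      have key := antidiagonal_parameter_deriv (fun k => χ⁻¹ * (χ ^ 2) ^ k * powerSum α k p)
        (fun k => χ⁻¹ * (χ ^ 2) ^ k * powerForm α k p e) (fun k => nullCoeff χ α k p)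
        (nullCoeff_recursion χ α p) (m + 1)
      have hm : ((m + 1 : ℕ) : ℂ) ≠ 0 := by exact_mod_cast m.succ_ne_zero
      simp only [smul_apply, sum_apply,
        add_apply, smul_eq_mul] at key ⊢
      trans -((m : ℂ) + 1)⁻¹ * (-((m + 1 : ℕ) : ℂ) * ∑ x ∈ antidiagonal (m + 1),
        χ⁻¹ * (χ ^ 2) ^ x.1 * powerForm α x.1 p e * nullCoeff χ α x.2 p)
      · rw [← key]
        congr 1
        refine Finset.sum_congr rfl fun x _ => ?_
        congr 1
        · congr 1
          exact Finset.sum_congr rfl fun y _ => by ring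
        · ring
      · push_cast at hm ⊢
        rw [← mul_assoc, neg_mul_neg, inv_mul_cancel₀ hm, one_mul]
        exact Finset.sum_congr rfl fun y _ => by ring

/-- The logarithmic differential of the Coulomb gas integrand. -/
noncomputable def logForm (r : ℕ) (χ : ℂ) (α : Fin N → ℂ) (p : ℝ × (Fin N → ℝ)) :
    ℝ × (Fin N → ℝ) →L[ℝ] ℂ :=
  (∑ i, ∑ j ∈ Finset.Ioi i,
      (-(α i * α j) / 2 * (gapForm j p - gapForm i p)⁻¹) • (gapForm j - gapForm i)) +
    ∑ i, (((r : ℂ) - 1) * χ * α i / 2 * invGap i p) • gapForm i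

lemma hasFDerivAt_prod_of_log {ι E : Type*} [NormedAddCommGroup E] [NormedSpace ℝ E]
    (s : Finset ι) (g : ι → E → ℂ) (θ : ι → E →L[ℝ] ℂ) (p : E)
    (h : ∀ i ∈ s, HasFDerivAt (g i) (g i p • θ i) p) :
    HasFDerivAt (fun q => ∏ i ∈ s, g i q) ((∏ i ∈ s, g i p) • ∑ i ∈ s, θ i) p := by
  classical
  induction s using Finset.induction_on with
  | empty => simpa using hasFDerivAt_const (𝕜 := ℝ) (1 : ℂ) p
  | insert a s ha ih =>
    simp only [Finset.prod_insert ha, Finset.sum_insert ha]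
    refine ((h a (Finset.mem_insert_self a s)).mul
      (ih fun i hi => h i (Finset.mem_insert_of_mem hi))).congr_fderiv ?_
    rw [smul_smul, smul_smul, smul_add, add_comm, mul_comm (∏ i ∈ s, g i p)]

lemma hasFDerivAt_cpow_of_pos {E : Type*} [NormedAddCommGroup E] [NormedSpace ℝ E]
    (g : E → ℝ) (θ : E →L[ℝ] ℂ) (hg : ∀ q, (g q : ℂ) = θ q) (c : ℂ) (p : E) (hp : 0 < g p) :
    HasFDerivAt (fun q => (g q : ℂ) ^ c) ((g p : ℂ) ^ c • (c * (θ p)⁻¹) • θ) p := by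
  have hslit : θ p ∈ Complex.slitPlane := by
    rw [← hg]
    exact Complex.ofReal_mem_slitPlane.2 hp
  have h0 : θ p ≠ 0 := Complex.slitPlane_ne_zero hslit
  have h := (Complex.hasStrictDerivAt_cpow_const (c := c)
    hslit).hasDerivAt.hasFDerivAt.restrictScalars ℝ
  simp only [hg]
  refine (h.comp p θ.hasFDerivAt).congr_fderiv ?_
  refine ContinuousLinearMap.ext fun e => ?_
  simp [Complex.cpow_sub _ _ h0]
  ring

lemma hasFDerivAt_fCG (r : ℕ) (χ : ℂ) (α : Fin N → ℂ) {p : ℝ × (Fin N → ℝ)}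
    (hp : p ∈ OrdDomain N) :
    HasFDerivAt (fCG N r χ α) (fCG N r χ α p • logForm r χ α p) p := by
  have h₁ := hasFDerivAt_prod_of_log Finset.univ _ _ p fun i _ =>
    hasFDerivAt_prod_of_log (Finset.Ioi i) _ _ p fun j hj =>
      hasFDerivAt_cpow_of_pos (fun q : ℝ × (Fin N → ℝ) => q.2 j - q.2 i) (gapForm j - gapForm i)
        (fun q => by simp [gapForm_apply]) (-(α i * α j) / 2) p
        (sub_pos.2 (hp.2 (Finset.mem_Ioi.1 hj)))
  have h₂ := hasFDerivAt_prod_of_log Finset.univ _ _ p fun i _ =>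
      hasFDerivAt_cpow_of_pos (fun q : ℝ × (Fin N → ℝ) => q.2 i - q.1) (gapForm i)
        (fun q => by simp [gapForm_apply]) (((r : ℂ) - 1) * χ * α i / 2) p
        (sub_pos.2 (hp.1 i))
  refine (h₁.mul h₂).congr_fderiv ?_
  rw [fCG, logForm, smul_smul, smul_smul, smul_add, add_comm]
  simp only [sub_apply, invGap]
  rw [mul_comm (∏ i, _) (∏ i, ∏ j ∈ _, _)]

/-- The complete homogeneous sum `∑ u ^ a * w ^ b` over `a + b = n`, `a, b ≥ 1`. -/
noncomputable def mixedSum (n : ℕ) (u w : ℂ) : ℂ :=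
  ∑ x ∈ antidiagonal n, if x.1 = 0 then 0 else if x.2 = 0 then 0 else u ^ x.1 * w ^ x.2

lemma mixedSum_comm (n : ℕ) (u w : ℂ) : mixedSum n u w = mixedSum n w u := by
  rw [mixedSum, ← Finset.Nat.sum_antidiagonal_swap, mixedSum]
  refine Finset.sum_congr rfl fun x _ => ?_
  simp only [Prod.fst_swap, Prod.snd_swap]
  split_ifs <;> first | rfl | ring

lemma mixedSum_self {n : ℕ} (hn : 1 ≤ n) (u : ℂ) : mixedSum n u u = ((n : ℂ) - 1) * u ^ n := by
  have := sum_antidiagonal_off_axes (fun k => if k = 0 then 0 else u ^ k) (by simp) n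
  simp only [show n ≠ 0 by omega, if_false] at this
  rw [← this, mixedSum]
  refine Finset.sum_congr rfl fun x hx => ?_
  rw [Finset.HasAntidiagonal.mem_antidiagonal] at hx
  rw [← pow_add, hx]

lemma sub_mul_mixedSum (m : ℕ) (u w : ℂ) :
    (u - w) * mixedSum (m + 1) u w = u * w * (u ^ m - w ^ m) := by
  rw [mixedSum, Finset.Nat.sum_antidiagonal_succ,
    Finset.Nat.sum_antidiagonal_eq_sum_range_succ_mk, Finset.sum_range_succ]
  rw [Finset.sum_congr rfl (g := fun i => u * w * (u ^ i * w ^ (m - 1 - i))) fun i hi => by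
    rw [Finset.mem_range] at hi
    rw [if_neg (by simp), if_neg (by simp only; omega)]
    simp only
    rw [show m - i = m - 1 - i + 1 by omega]
    ring]
  rw [← Finset.mul_sum]
  simp only [if_true, zero_add, Nat.sub_self, Nat.succ_ne_zero, if_false, add_zero]
  rw [← geom_sum₂_mul u w m]
  ring

lemma sum_powerSum_mul_powerSum (α : Fin N → ℂ) (n : ℕ) (p : ℝ × (Fin N → ℝ)) :
    ∑ x ∈ antidiagonal n, powerSum α x.1 p * powerSum α x.2 p =
      ∑ i, ∑ j, α j / 2 * (α i / 2) * mixedSum n (invGap j p) (invGap i p) := by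
  simp only [mixedSum, Finset.mul_sum]
  conv_rhs =>
    enter [2, i]
    rw [Finset.sum_comm]
  rw [Finset.sum_comm (s := Finset.univ)]
  refine Finset.sum_congr rfl fun x _ => ?_
  unfold powerSum
  split_ifs
  · simp
  · simp
  · simp
  · rw [Finset.sum_mul_sum, Finset.sum_comm]
    exact Finset.sum_congr rfl fun i _ => Finset.sum_congr rfl fun j _ => by ring

lemma modeField_logForm (r : ℕ) (χ : ℂ) (α : Fin N → ℂ) {n : ℕ} (hn : 1 ≤ n)
    {p : ℝ × (Fin N → ℝ)} (hp : p ∈ OrdDomain N) :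
    modeField n p (logForm r χ α p) =
      -∑ x ∈ antidiagonal n, powerSum α x.1 p * powerSum α x.2 p +
        ((n : ℂ) - 1) * ∑ l, (α l / 2) ^ 2 * invGap l p ^ n -
        ((r : ℂ) - 1) * χ * powerSum α n p := by
  have hpair (i j : Fin N) (hij : i < j) :
      (gapForm j p - gapForm i p)⁻¹ * (invGap j p ^ (n - 1) - invGap i p ^ (n - 1)) =
        -mixedSum n (invGap j p) (invGap i p) := by
    obtain ⟨m, rfl⟩ : ∃ m, n = m + 1 := ⟨n - 1, by omega⟩
    have hi := gapForm_ne_zero hp i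
    have hj := gapForm_ne_zero hp j
    have hne : gapForm j p - gapForm i p ≠ 0 := by
      rw [gapForm_apply, gapForm_apply, sub_sub_sub_cancel_right, sub_ne_zero]
      exact_mod_cast (hp.2 hij).ne'
    have key := sub_mul_mixedSum m (invGap j p) (invGap i p)
    have hsub : invGap j p - invGap i p =
        -(gapForm j p - gapForm i p) * (invGap j p * invGap i p) := by
      simp only [invGap]
      field_simp
      ring
    have hprod : invGap j p * invGap i p ≠ 0 := mul_ne_zero (inv_ne_zero hj) (inv_ne_zero hi)
    rw [Nat.add_sub_cancel, inv_mul_eq_iff_eq_mul₀ hne]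
    apply mul_left_cancel₀ hprod
    rw [← key, hsub]
    ring
  have hsum : modeField n p (logForm r χ α p) =
      -∑ i, ∑ j ∈ Finset.Ioi i,
        (α j / 2 * (α i / 2) * mixedSum n (invGap j p) (invGap i p) +
          α i / 2 * (α j / 2) * mixedSum n (invGap i p) (invGap j p)) -
        ((r : ℂ) - 1) * χ * powerSum α n p := by
    rw [logForm, map_add, map_sum, map_sum]
    refine (congrArg₂ (· + ·) ?_ ?_).trans (sub_eq_add_neg _ _).symm
    · rw [← Finset.sum_neg_distrib]
      refine Finset.sum_congr rfl fun i _ => ?_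
      rw [map_sum, ← Finset.sum_neg_distrib]
      refine Finset.sum_congr rfl fun j hj => ?_
      rw [map_smul, map_sub, modeField_gapForm, modeField_gapForm, smul_eq_mul,
        mixedSum_comm n (invGap i p)]
      linear_combination α i * α j / 2 * hpair i j (Finset.mem_Ioi.1 hj)
    · rw [powerSum, if_neg (by omega), Finset.mul_sum, ← Finset.sum_neg_distrib]
      refine Finset.sum_congr rfl fun i _ => ?_
      rw [map_smul, modeField_gapForm, smul_eq_mul]
      obtain ⟨m, rfl⟩ : ∃ m, n = m + 1 := ⟨n - 1, by omega⟩
      rw [Nat.add_sub_cancel]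
      ring
  have hdiag : ∑ i, ∑ j, α j / 2 * (α i / 2) * mixedSum n (invGap j p) (invGap i p) =
      ((n : ℂ) - 1) * ∑ l, (α l / 2) ^ 2 * invGap l p ^ n +
      ∑ i, ∑ j ∈ {i}ᶜ, α j / 2 * (α i / 2) * mixedSum n (invGap j p) (invGap i p) := by
    rw [Finset.mul_sum, ← Finset.sum_add_distrib]
    refine Finset.sum_congr rfl fun i _ => ?_
    rw [Fintype.sum_eq_add_sum_compl i, mixedSum_self hn]
    ring
  rw [hsum, sum_powerSum_mul_powerSum, hdiag, Finset.sum_sum_Ioi_add_eq_sum_sum_off_diag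
    fun j i => α j / 2 * (α i / 2) * mixedSum n (invGap j p) (invGap i p)]
  ring

/-- The action of `L_{-n}` on a multiple of the integrand, in the charged Fock representation. -/
lemma Lop_fCG_mul_nullCoeff (r : ℕ) (χ Q : ℂ) (α : Fin N → ℂ) {n : ℕ} (hn : 1 ≤ n) (m : ℕ)
    {p : ℝ × (Fin N → ℝ)} (hp : p ∈ OrdDomain N) :
    Lop N (fun l => α l / 2 * (Q - α l / 2)) n
        (fun q => fCG N r χ α q * nullCoeff χ α m q) p =
      fCG N r χ α p *
        ((∑ x ∈ antidiagonal m, χ⁻¹ * (χ ^ 2) ^ x.1 *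
            (if x.1 = 0 then 0 else -powerSum α (x.1 + n) p) * nullCoeff χ α x.2 p) +
          (-∑ x ∈ antidiagonal n, powerSum α x.1 p * powerSum α x.2 p
            + (((n : ℂ) - 1) * Q - ((r : ℂ) - 1) * χ) * powerSum α n p) *
              nullCoeff χ α m p) := by
  have hd := (hasFDerivAt_fCG r χ α hp).fun_mul (hasFDerivAt_nullCoeff χ α m hp)
  have hΔ : ∑ l, α l / 2 * (Q - α l / 2) * invGap l p ^ n =
      Q * powerSum α n p - ∑ l, (α l / 2) ^ 2 * invGap l p ^ n := by
    rw [powerSum, if_neg (by omega), Finset.mul_sum, ← Finset.sum_sub_distrib]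
    exact Finset.sum_congr rfl fun l _ => by ring
  have hv : modeField n p (∑ x ∈ antidiagonal m,
      (χ⁻¹ * (χ ^ 2) ^ x.1 * nullCoeff χ α x.2 p) • powerForm α x.1 p) =
      ∑ x ∈ antidiagonal m, χ⁻¹ * (χ ^ 2) ^ x.1 *
        (if x.1 = 0 then 0 else -powerSum α (x.1 + n) p) * nullCoeff χ α x.2 p := by
    rw [map_sum]
    refine Finset.sum_congr rfl fun x _ => ?_
    rw [map_smul, modeField_powerForm α hn, smul_eq_mul]
    ring
  rw [Lop_eq_modeField, HasFDerivAt.fderiv hd, map_add, map_smul, map_smul, map_smul, hv,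
    modeField_logForm r χ α hn hp, hΔ]
  simp only [smul_eq_mul]
  ring

end CoulombGas

section SmoothFunctions

open Finset.HasAntidiagonal (antidiagonal)
open scoped ContDiff

variable {N : ℕ}

lemma isOpen_ordDomain (N : ℕ) : IsOpen (OrdDomain N) := by
  have h : OrdDomain N = (⋂ l, {p | p.1 < p.2 l}) ∩
      ⋂ i, ⋂ j, ⋂ (_ : i < j), {p : ℝ × (Fin N → ℝ) | p.2 i < p.2 j} := by
    ext p
    simp [OrdDomain, StrictMono]
  rw [h]
  refine (isOpen_iInter_of_finite fun l => ?_).inter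
    (isOpen_iInter_of_finite fun i => isOpen_iInter_of_finite fun j =>
      isOpen_iInter_of_finite fun _ => ?_)
  · exact isOpen_lt (by fun_prop) (by fun_prop)
  · exact isOpen_lt (by fun_prop) (by fun_prop)

/-- Functions that are smooth on the ordered domain. -/
noncomputable def smoothOn (N : ℕ) : Submodule ℂ (ℝ × (Fin N → ℝ) → ℂ) where
  carrier := {F | ContDiffOn ℝ ∞ F (OrdDomain N)}
  add_mem' hF hG := ContDiffOn.add hF hG
  zero_mem' := contDiffOn_const
  smul_mem' c _ hF := ContDiffOn.const_smul c hF

lemma contDiffOn_invGap (l : Fin N) : ContDiffOn ℝ ∞ (invGap l) (OrdDomain N) :=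
  (gapForm l).contDiff.contDiffOn.inv fun _ hp => gapForm_ne_zero hp l

lemma contDiffOn_powerSum (α : Fin N → ℂ) (k : ℕ) :
    ContDiffOn ℝ ∞ (powerSum α k) (OrdDomain N) := by
  unfold powerSum
  split_ifs
  · exact contDiffOn_const
  · exact ContDiffOn.sum fun l _ => contDiffOn_const.mul ((contDiffOn_invGap l).pow k)

lemma contDiffOn_nullCoeff (χ : ℂ) (α : Fin N → ℂ) (m : ℕ) :
    ContDiffOn ℝ ∞ (nullCoeff χ α m) (OrdDomain N) := by
  induction m using Nat.strong_induction_on with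
  | _ m ih =>
    rcases m with _ | m
    · rw [nullCoeff]
      exact contDiffOn_const
    · rw [nullCoeff]
      exact contDiffOn_const.mul (ContDiffOn.sum fun k _ =>
        (contDiffOn_const.mul (contDiffOn_powerSum α _)).mul (ih _ (by omega)))

lemma contDiffOn_cpow_of_pos (g : ℝ × (Fin N → ℝ) → ℝ) (hg : ContDiff ℝ ∞ g)
    (hpos : ∀ p ∈ OrdDomain N, 0 < g p) (c : ℂ) :
    ContDiffOn ℝ ∞ (fun p => (g p : ℂ) ^ c) (OrdDomain N) := by
  have h : ContDiffOn ℝ ∞ (fun p => Complex.exp (((Real.log (g p) : ℝ) : ℂ) * c))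
      (OrdDomain N) :=
    (((Complex.ofRealCLM.contDiff.comp_contDiffOn
      (hg.contDiffOn.log fun p hp => (hpos p hp).ne')).mul contDiffOn_const).cexp)
  refine h.congr fun p hp => ?_
  rw [Complex.cpow_def_of_ne_zero (by exact_mod_cast (hpos p hp).ne'),
    Complex.ofReal_log (hpos p hp).le]

lemma contDiffOn_fCG (r : ℕ) (χ : ℂ) (α : Fin N → ℂ) :
    ContDiffOn ℝ ∞ (fCG N r χ α) (OrdDomain N) := by
  unfold fCG
  refine ContDiffOn.mul (contDiffOn_prod fun i _ => contDiffOn_prod fun j hj => ?_)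
    (contDiffOn_prod fun i _ => ?_)
  · exact contDiffOn_cpow_of_pos (fun p => p.2 j - p.2 i) (by fun_prop)
      (fun p hp => sub_pos.2 (hp.2 (Finset.mem_Ioi.1 hj))) _
  · exact contDiffOn_cpow_of_pos (fun p => p.2 i - p.1) (by fun_prop)
      (fun p hp => sub_pos.2 (hp.1 i)) _

lemma contDiffOn_Lop (Δ : Fin N → ℂ) (n : ℕ) {F : ℝ × (Fin N → ℝ) → ℂ}
    (hF : ContDiffOn ℝ ∞ F (OrdDomain N)) : ContDiffOn ℝ ∞ (Lop N Δ n F) (OrdDomain N) := by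
  have hd (e : ℝ × (Fin N → ℝ)) : ContDiffOn ℝ ∞ (fun p => fderiv ℝ F p e) (OrdDomain N) :=
    (hF.fderiv_of_isOpen (isOpen_ordDomain N) le_rfl).clm_apply contDiffOn_const
  have h (p : ℝ × (Fin N → ℝ)) : Lop N Δ n F p =
      (if n = 1 then fderiv ℝ F p (1, 0)
        else ∑ l, -(invGap l p ^ (n - 1)) * fderiv ℝ F p (0, Pi.single l 1)) +
      ((n : ℂ) - 1) * (∑ l, Δ l * invGap l p ^ n) * F p :=
    Lop_eq_modeField Δ n F p
  rw [funext h]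
  refine ContDiffOn.add ?_ ((contDiffOn_const.mul (ContDiffOn.sum fun l _ =>
    contDiffOn_const.mul ((contDiffOn_invGap l).pow n))).mul hF)
  split_ifs
  · exact hd _
  · exact ContDiffOn.sum fun l _ => ((contDiffOn_invGap l).pow _).neg.mul (hd _)

lemma Lop_congr (Δ : Fin N → ℂ) (n : ℕ) {F G : ℝ × (Fin N → ℝ) → ℂ}
    (h : Set.EqOn F G (OrdDomain N)) :
    Set.EqOn (Lop N Δ n F) (Lop N Δ n G) (OrdDomain N) := by
  intro p hp
  have : fderiv ℝ F p = fderiv ℝ G p :=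
    (h.eventuallyEq_of_mem ((isOpen_ordDomain N).mem_nhds hp)).fderiv_eq
  rw [Lop_eq_modeField, Lop_eq_modeField, this, h hp]

lemma differentiableAt_of_mem_smoothOn {F : ℝ × (Fin N → ℝ) → ℂ} (hF : F ∈ smoothOn N)
    {p : ℝ × (Fin N → ℝ)} (hp : p ∈ OrdDomain N) : DifferentiableAt ℝ F p :=
  (ContDiffOn.contDiffAt hF ((isOpen_ordDomain N).mem_nhds hp)).differentiableAt (by simp)

/-- The operator `L_{-n}`, cut off outside the ordered domain, as a linear endomorphism of the
functions smooth on that domain. -/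
noncomputable def modeOp (Δ : Fin N → ℂ) (n : ℕ) : smoothOn N →ₗ[ℂ] smoothOn N where
  toFun F := ⟨(OrdDomain N).indicator (Lop N Δ n F.1),
    (contDiffOn_Lop Δ n F.2).congr fun _ hp => Set.indicator_of_mem hp _⟩
  map_add' F G := by
    ext p
    by_cases hp : p ∈ OrdDomain N
    · have hd : fderiv ℝ (F.1 + G.1) p = fderiv ℝ F.1 p + fderiv ℝ G.1 p :=
        fderiv_add (differentiableAt_of_mem_smoothOn F.2 hp)
          (differentiableAt_of_mem_smoothOn G.2 hp)
      simp only [Submodule.coe_add, Pi.add_apply, Set.indicator_of_mem hp, Lop_eq_modeField, hd,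
        map_add]
      ring
    · simp [Set.indicator_of_notMem hp]
  map_smul' c F := by
    ext p
    by_cases hp : p ∈ OrdDomain N
    · have hd : fderiv ℝ (c • F.1) p = c • fderiv ℝ F.1 p :=
        fderiv_const_smul (differentiableAt_of_mem_smoothOn F.2 hp) c
      simp only [Submodule.coe_smul, Pi.smul_apply, Set.indicator_of_mem hp, Lop_eq_modeField, hd,
        map_smul, smul_eq_mul, RingHom.id_apply]
      ring
    · simp [Set.indicator_of_notMem hp]

lemma modeOp_apply (Δ : Fin N → ℂ) (n : ℕ) (F : smoothOn N) {p : ℝ × (Fin N → ℝ)}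
    (hp : p ∈ OrdDomain N) : (modeOp Δ n F).1 p = Lop N Δ n F.1 p :=
  Set.indicator_of_mem hp _

lemma eqOn_foldr_modeOp (Δ : Fin N → ℂ) (F : ℝ × (Fin N → ℝ) → ℂ) (G : smoothOn N)
    (hFG : Set.EqOn F G.1 (OrdDomain N)) (w : List ℕ) :
    Set.EqOn (w.foldr (Lop N Δ) F) (w.foldr (fun a y => modeOp Δ a y) G).1 (OrdDomain N) := by
  induction w with
  | nil => exact hFG
  | cons a w ih =>
    intro p hp
    rw [List.foldr_cons, List.foldr_cons, modeOp_apply _ _ _ hp]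
    exact Lop_congr Δ a ih hp

/-- The level `m` descendants of the integrand obtained from `nullCoeff`, cut off outside the
ordered domain. -/
noncomputable def descendant (r : ℕ) (χ : ℂ) (α : Fin N → ℂ) (m : ℕ) : smoothOn N :=
  ⟨(OrdDomain N).indicator fun q => fCG N r χ α q * nullCoeff χ α m q,
    ((contDiffOn_fCG r χ α).mul (contDiffOn_nullCoeff χ α m)).congr
      fun _ hp => Set.indicator_of_mem hp _⟩

lemma descendant_eqOn (r : ℕ) (χ : ℂ) (α : Fin N → ℂ) (m : ℕ) :
    Set.EqOn (descendant r χ α m).1 (fun q => fCG N r χ α q * nullCoeff χ α m q)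
      (OrdDomain N) := by
  intro p hp
  simp [descendant, Set.indicator_of_mem hp]

lemma descendant_recursion (r : ℕ) (χ Q : ℂ) (hχ : χ ≠ 0) (hQ : Q = χ + χ⁻¹) (α : Fin N → ℂ)
    (m : ℕ) :
    ((m : ℂ) * ((r : ℂ) - m)) • descendant r χ α m = ∑ a ∈ Finset.Icc 1 m,
      χ ^ (2 * (a - 1)) •
        modeOp (fun l => α l / 2 * (Q - α l / 2)) a (descendant r χ α (m - a)) := by
  ext p
  simp only [Submodule.coe_smul, Submodule.coe_sum, Finset.sum_apply, Pi.smul_apply, smul_eq_mul]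
  by_cases hp : p ∈ OrdDomain N
  · rw [descendant_eqOn r χ α m hp]
    have hP : powerSum α 0 p = 0 := by simp [powerSum]
    have key := fock_recursion χ Q r hχ hQ (fun k => powerSum α k p)
      (fun k => nullCoeff χ α k p) hP (nullCoeff_recursion χ α p) m
    trans fCG N r χ α p * ((m : ℂ) * ((r : ℂ) - m) * nullCoeff χ α m p)
    · ring
    · rw [← key, Finset.mul_sum]
      refine Finset.sum_congr rfl fun a ha => ?_
      rw [modeOp_apply _ _ _ hp, Lop_congr _ a (descendant_eqOn r χ α (m - a)) hp,
        Lop_fCG_mul_nullCoeff r χ Q α (Finset.mem_Icc.1 ha).1 (m - a) hp]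
      ring
  · simp [descendant, modeOp, Set.indicator_of_notMem hp]

end SmoothFunctions

/-- The Benoît–Saint-Aubin operator of order `r` annihilates the Coulomb gas
integrand on the ordered domain `{t < t₁ < ⋯ < t_N}`, for `χ = γ/2` or `χ = 2/γ`. -/
theorem BSA_annihilates_integrand (N : ℕ) (hN : 1 ≤ N) (r : ℕ) (hr : 1 ≤ r)
    (γ χ : ℂ) (hγ : γ ≠ 0) (hχ : χ = γ / 2 ∨ χ = 2 / γ) (α : Fin N → ℂ) :
    ∀ p ∈ OrdDomain N,
      Dr N (fun l => α l / 2 * ((γ / 2 + 2 / γ) - α l / 2)) r χ (fCG N r χ α) p = 0 := by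
  intro p hp
  have hχ0 : χ ≠ 0 := by
    rcases hχ with rfl | rfl
    · exact div_ne_zero hγ two_ne_zero
    · exact div_ne_zero two_ne_zero hγ
  have hQ : γ / 2 + 2 / γ = χ + χ⁻¹ := by
    rcases hχ with rfl | rfl
    · rw [inv_div]
    · rw [inv_div, add_comm]
  generalize γ / 2 + 2 / γ = Q at hQ ⊢
  set Δ : Fin N → ℂ := fun l => α l / 2 * (Q - α l / 2)
  have hzero := BSA_sum_eq_zero_of_recursion (modeOp Δ) r hr χ (descendant r χ α 0)
    (descendant r χ α) rfl fun m _ => descendant_recursion r χ Q hχ0 hQ α m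
  have hstart : Set.EqOn (fCG N r χ α) (descendant r χ α 0).1 (OrdDomain N) := fun q hq => by
    rw [descendant_eqOn r χ α 0 hq]
    simp [nullCoeff]
  have hp0 := congrFun (congrArg Subtype.val hzero) p
  simp only [Submodule.coe_sum, Submodule.coe_smul, Finset.sum_apply, Pi.smul_apply,
    smul_eq_mul] at hp0
  rw [Dr, ← show ((0 : smoothOn N) : ℝ × (Fin N → ℝ) → ℂ) p = 0 from rfl, ← hp0]
  refine Finset.sum_congr rfl fun k _ => Finset.sum_congr rfl fun n _ => ?_
  rw [eqOn_foldr_modeOp Δ _ _ hstart _ hp]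
end
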